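/- Let R be a type II₁ injective von Neumann algebra with trace τ, identified as R ≅ (Z ⊗ R_0) ⊗ M_2(ℂ) for an abelian Z and the hyperfinite II₁ factor R_0. If A is a maximal abelian von Neumann subalgebra of R, then there exists a unitary w ∈ R with τ(w a) = 0 for all a ∈ A. -/

import Mathlib

open Filter Topology

section helpers

variable {H : Type*} [NormedAddCommGroup H] [InnerProductSpace ℂ H] [CompleteSpace H]

lemma exists_span_proj (F : Set (H →L[ℂ] H)) :
    ∃ p : H →L[ℂ] H, IsStarProjection p ∧ (∀ y ∈ F, p * y = y) ∧
      ∀ b : H →L[ℂ] H, (∀ y ∈ F, b * y = 0) → b * p = 0 := by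
  set K : Submodule ℂ H := (⨆ y ∈ F, LinearMap.range (y : H →ₗ[ℂ] H)).topologicalClosure with hK
  have : CompleteSpace K := (Submodule.isClosed_topologicalClosure _).completeSpace_coe
  refine ⟨K.starProjection, isStarProjection_starProjection, ?_, ?_⟩
  · intro y hy
    ext ξ
    simp only [mul_apply_eq_comp]
    rw [Submodule.starProjection_eq_self_iff]
    apply Submodule.le_topologicalClosure
    exact (le_iSup₂_of_le (f := fun y (_ : y ∈ F) => LinearMap.range (y : H →ₗ[ℂ] H)) y hy le_rfl)
      ⟨ξ, rfl⟩
  · intro b hb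
    have hle : K ≤ LinearMap.ker (b : H →ₗ[ℂ] H) := by
      apply Submodule.topologicalClosure_minimal
      · refine iSup₂_le fun y hy => ?_
        rintro _ ⟨ξ, rfl⟩
        have := congrArg (fun T : H →L[ℂ] H => T ξ) (hb y hy)
        simpa using this
      · exact ContinuousLinearMap.isClosed_ker b
    ext ξ
    have := hle (Submodule.starProjection_apply_mem K ξ)
    simpa using this

lemma exists_span_proj' (F : Set (H →L[ℂ] H)) :
    ∃ p : H →L[ℂ] H, IsStarProjection p ∧ (∀ y ∈ F, p * y = y) ∧
      (∀ b : H →L[ℂ] H, (∀ y ∈ F, b * y = 0) → b * p = 0) ∧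
      ∀ t : H →L[ℂ] H, (∀ y ∈ F, ∃ y' ∈ F, ∃ r, t * y = y' * r) →
        (∀ y ∈ F, ∃ y' ∈ F, ∃ r, star t * y = y' * r) → t * p = p * t := by
  obtain ⟨p, hp, h1, h2⟩ := exists_span_proj F
  refine ⟨p, hp, h1, h2, ?_⟩
  have key : ∀ t : H →L[ℂ] H, (∀ y ∈ F, ∃ y' ∈ F, ∃ r, t * y = y' * r) → p * t * p = t * p := by
    intro t ht
    have := h2 (p * t - t) (by
      intro y hy
      obtain ⟨y', hy', r, hr⟩ := ht y hy
      rw [sub_mul, mul_assoc, hr, ← mul_assoc, h1 y' hy', sub_self])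
    rw [sub_mul] at this
    exact sub_eq_zero.mp this
  intro t ht ht'
  have a1 := key t ht
  have a2 := congrArg star (key _ ht')
  simp only [star_mul, star_star, hp.isSelfAdjoint.star_eq] at a2
  rw [← a1, mul_assoc, a2]

lemma exists_range_proj (a : H →L[ℂ] H) :
    ∃ p : H →L[ℂ] H, IsStarProjection p ∧ p * a = a ∧
      (∀ b : H →L[ℂ] H, b * a = 0 → b * p = 0) ∧
      ∀ t : H →L[ℂ] H, t * a = a * t → star t * a = a * star t → t * p = p * t := by
  obtain ⟨p, hp, h1, h2, h3⟩ := exists_span_proj' {a}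
  refine ⟨p, hp, h1 a rfl, fun b hb => h2 b (by rintro y rfl; exact hb), fun t ht ht' => h3 t ?_ ?_⟩
  · rintro y rfl; exact ⟨y, rfl, t, ht⟩
  · rintro y rfl; exact ⟨y, rfl, star t, ht'⟩

lemma wot_limit {ι : Type*} (U : Ultrafilter ι) (f : ι → H →L[ℂ] H) (hf : ∀ i, ‖f i‖ ≤ 1) :
    ∃ w : H →L[ℂ] H, ∀ ξ η : H, Tendsto (fun i => inner ℂ (f i ξ) η) U (𝓝 (inner ℂ (w ξ) η)) := by
  have hb : ∀ ξ η : H, ∀ i, ‖inner ℂ (f i ξ) η‖ ≤ ‖ξ‖ * ‖η‖ := by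
    intro ξ η i
    refine (norm_inner_le_norm _ _).trans ?_
    gcongr
    exact ((f i).le_of_opNorm_le (hf i) ξ).trans (by simp)
  have hlim : ∀ ξ η : H, ∃ c : ℂ, ‖c‖ ≤ ‖ξ‖ * ‖η‖ ∧
      Tendsto (fun i => inner ℂ (f i ξ) η) U (𝓝 c) := by
    intro ξ η
    have hc := isCompact_closedBall (0 : ℂ) (‖ξ‖ * ‖η‖)
    obtain ⟨c, hc1, hc2⟩ := hc.ultrafilter_le_nhds (U.map (fun i => inner ℂ (f i ξ) η)) (by
      rw [le_principal_iff]
      refine Filter.mem_map.mpr (Filter.univ_mem' fun i => ?_)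
      simpa using hb ξ η i)
    exact ⟨c, by simpa using hc1, hc2⟩
  choose B hB1 hB2 using hlim
  let L : H →ₗ⋆[ℂ] H →ₗ[ℂ] ℂ := LinearMap.mk₂'ₛₗ (starRingEnd ℂ) (RingHom.id ℂ) B
    (by
      intro x y z
      refine tendsto_nhds_unique (hB2 _ _) ?_
      simpa [inner_add_left] using (hB2 x z).add (hB2 y z))
    (by
      intro c x y
      refine tendsto_nhds_unique (hB2 _ _) ?_
      simpa [inner_smul_left, mul_comm] using (hB2 x y).const_mul (starRingEnd ℂ c))
    (by
      intro x y z
      refine tendsto_nhds_unique (hB2 _ _) ?_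
      simpa [inner_add_right] using (hB2 x y).add (hB2 x z))
    (by
      intro c x y
      refine tendsto_nhds_unique (hB2 _ _) ?_
      simpa [inner_smul_right] using (hB2 x y).const_mul c)
  let B' : H →L⋆[ℂ] H →L[ℂ] ℂ := L.mkContinuous₂ 1 (by intro x y; simpa [L] using hB1 x y)
  refine ⟨InnerProductSpace.continuousLinearMapOfBilin B', fun ξ η => ?_⟩
  rw [InnerProductSpace.continuousLinearMapOfBilin_apply]
  exact hB2 ξ η

lemma wot_eq {ι : Type*} (U : Ultrafilter ι) (f : ι → H →L[ℂ] H) (w : H →L[ℂ] H)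
    (hw : ∀ ξ η : H, Tendsto (fun i => inner ℂ (f i ξ) η) U (𝓝 (inner ℂ (w ξ) η)))
    (a b c d k : H →L[ℂ] H) (h : ∀ᶠ i in (U : Filter ι), a * f i * b = c * f i * d + k) :
    a * w * b = c * w * d + k := by
  have key : ∀ (a b : H →L[ℂ] H) (ξ η : H),
      Tendsto (fun i => inner ℂ ((a * f i * b) ξ) η) U (𝓝 (inner ℂ ((a * w * b) ξ) η)) := by
    intro a b ξ η
    have := hw (b ξ) (star a η)
    simpa [ContinuousLinearMap.star_eq_adjoint, ContinuousLinearMap.adjoint_inner_right] using this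
  ext ξ
  refine ext_inner_right ℂ fun η => ?_
  refine tendsto_nhds_unique (key a b ξ η) ?_
  have h2 : Tendsto (fun i => inner ℂ ((c * f i * d + k) ξ) η) U
      (𝓝 (inner ℂ ((c * w * d + k) ξ) η)) := by
    simpa [inner_add_left] using (key c d ξ η).add_const (inner ℂ (k ξ) η)
  refine h2.congr' ?_
  filter_upwards [h] with i hi
  rw [hi]

lemma pi_norm (v : H →L[ℂ] H) (hv : v * star v * v = v) : ‖v‖ ≤ 1 := by
  have h1 : ‖star v * v‖ = ‖v‖ * ‖v‖ := CStarRing.norm_star_mul_self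
  have h2 : ‖star (star v * v) * (star v * v)‖ = ‖star v * v‖ * ‖star v * v‖ :=
    CStarRing.norm_star_mul_self
  have h3 : star (star v * v) * (star v * v) = star v * v := by
    rw [star_mul, star_star, mul_assoc, ← mul_assoc v, hv]
  rw [h3, h1] at h2
  by_contra hc
  push Not at hc
  have h4 : 1 < ‖v‖ * ‖v‖ := by nlinarith
  nlinarith

/-- `x` lies in the double commutant. -/
def IsDC (M : StarSubalgebra ℂ (H →L[ℂ] H)) : Prop :=
  ∀ x : H →L[ℂ] H, (∀ t : H →L[ℂ] H, (∀ y ∈ M, t * y = y * t) → t * x = x * t) → x ∈ M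

lemma comm_star {M : StarSubalgebra ℂ (H →L[ℂ] H)} {t : H →L[ℂ] H}
    (ht : ∀ y ∈ M, t * y = y * t) : ∀ y ∈ M, star t * y = y * star t := by
  intro y hy
  have := congrArg star (ht (star y) (star_mem hy))
  simpa using this.symm

lemma cfc_comm {h t : H →L[ℂ] H} (hh : IsSelfAdjoint h) (ht : t * h = h * t) (f : ℝ → ℝ) :
    t * cfc f h = cfc f h * t :=
  (IsSelfAdjoint.commute_cfc hh (show Commute h t from ht.symm) f).eq.symm

lemma exists_pi {M : StarSubalgebra ℂ (H →L[ℂ] H)} (hM : IsDC M) {p q x : H →L[ℂ] H}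
    (hp : IsStarProjection p) (hq : IsStarProjection q) (hpM : p ∈ M) (hqM : q ∈ M)
    (hx : x ∈ M) (hne : q * x * p ≠ 0) :
    ∃ v ∈ M, v ≠ 0 ∧ v * star v * v = v ∧ v * p = v ∧ q * v = v := by
  set y := q * x * p with hy
  have hyM : y ∈ M := mul_mem (mul_mem hqM hx) hpM
  have hyp : y * p = y := by rw [hy, mul_assoc, hp.isIdempotentElem.eq]
  have hqy : q * y = y := by rw [hy, ← mul_assoc, ← mul_assoc, hq.isIdempotentElem.eq]
  set h := star y * y with hh
  have hhM : h ∈ M := mul_mem (star_mem hyM) hyM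
  have hsa : IsSelfAdjoint h := IsSelfAdjoint.star_mul_self y
  have hph : p * h = h := by
    have := congrArg star hyp
    rw [star_mul, hp.isSelfAdjoint.star_eq] at this
    rw [hh, ← mul_assoc, this]
  have hnorm : 0 < ‖h‖ := by
    rw [norm_pos_iff, hh]
    intro h0
    exact hne ((CStarRing.star_mul_self_eq_zero_iff y).mp h0)
  set ε := ‖h‖ / 2 with hε
  have hε0 : 0 < ε := by positivity
  set g : ℝ → ℝ := fun t => (Real.sqrt (max t ε))⁻¹ with hg
  have hmax : ∀ t : ℝ, 0 < max t ε := fun t => lt_max_of_lt_right hε0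
  have hgc : Continuous g := by
    refine Continuous.inv₀ (by fun_prop) fun t => (Real.sqrt_pos.mpr (hmax t)).ne'
  set m : ℝ → ℝ := fun t => max (t - ε) 0 with hm
  have hmc : Continuous m := by fun_prop
  set G := cfc g h with hG
  set F := cfc (fun t => t * m t) h with hF
  have hGsa : star G = G := (cfc_predicate g h : IsSelfAdjoint _).star_eq
  have hFh : F = h * cfc m h := by
    rw [hF, cfc_mul (fun t => t) m h (by fun_prop) (by fun_prop), cfc_id' ℝ h]
  have hGhG : (G * h * G - 1) * F = 0 := by
    have e1 : G * h * G - 1 = cfc (fun t => g t * t * g t - 1) h := by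
      rw [cfc_sub _ _ h (by fun_prop) (by fun_prop), cfc_const_one ℝ h,
        cfc_mul _ _ h (by fun_prop) (by fun_prop), cfc_mul _ _ h (by fun_prop) (by fun_prop),
        cfc_id' ℝ h]
    rw [e1, hF, ← cfc_mul _ _ h (by fun_prop) (by fun_prop)]
    rw [← cfc_const_zero ℝ h]
    congr 1
    ext t
    rcases le_total t ε with ht | ht
    · simp [hm, ht]
    · have : g t * t * g t = 1 := by
        have h0 : 0 < t := lt_of_lt_of_le hε0 ht
        have h1 : 0 < Real.sqrt t := Real.sqrt_pos.mpr h0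
        simp only [hg, max_eq_left ht]
        field_simp
        exact (Real.sq_sqrt h0.le).symm
      simp [this]
  have hF0 : F ≠ 0 := by
    intro hF0
    have h1 : ‖F‖ ≤ 0 := by simp [hF0]
    rw [hF, norm_cfc_le_iff _ h le_rfl (by fun_prop)] at h1
    have h2 : ‖cfc (fun t : ℝ => t) h‖ ≤ ε := by
      rw [norm_cfc_le_iff _ h hε0.le (by fun_prop)]
      intro t ht
      have h3 := h1 t ht
      have h4 : 0 ≤ t := spectrum_star_mul_self_nonneg t ht
      rw [Real.norm_of_nonneg h4]
      by_contra hc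
      push Not at hc
      have h5 : 0 < t * m t := by
        refine mul_pos (hε0.trans hc) ?_
        simp only [hm]
        exact lt_max_of_lt_left (by linarith)
      rw [Real.norm_of_nonneg h5.le] at h3
      linarith
    rw [cfc_id' ℝ h] at h2
    linarith
  obtain ⟨e, he, heF, hb, hcomm⟩ := exists_range_proj F
  have hes : star e = e := he.isSelfAdjoint.star_eq
  have hee : e * e = e := he.isIdempotentElem.eq
  have hGe : G * h * G * e = e := by
    have := hb _ hGhG
    rw [sub_mul, one_mul] at this
    exact sub_eq_zero.mp this
  have hpe : p * e = e := by
    have := hb (p - 1) (by rw [hFh, ← mul_assoc, sub_mul, hph, one_mul, sub_self, zero_mul])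
    rw [sub_mul, one_mul] at this
    exact sub_eq_zero.mp this
  have hep : e * p = e := by
    have := congrArg star hpe
    rwa [star_mul, hes, hp.isSelfAdjoint.star_eq] at this
  have he0 : e ≠ 0 := by
    rintro rfl
    exact hF0 (by rw [← heF, zero_mul])
  have hvv : star (y * G * e) * (y * G * e) = e := by
    calc star (y * G * e) * (y * G * e) = e * (G * h * G * e) := by
          simp only [star_mul, hes, hGsa, hh, mul_assoc]
      _ = e := by rw [hGe, hee]
  refine ⟨y * G * e, ?_, ?_, ?_, ?_, ?_⟩
  · have hGM : G ∈ M := hM _ fun t ht => cfc_comm hsa (ht h hhM) g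
    have heM : e ∈ M := hM _ fun t ht =>
      hcomm t (cfc_comm hsa (ht h hhM) _) (cfc_comm hsa (comm_star ht h hhM) _)
    exact mul_mem (mul_mem hyM hGM) heM
  · intro h0
    rw [h0, mul_zero] at hvv
    exact he0 hvv.symm
  · rw [mul_assoc, hvv, mul_assoc, hee]
  · rw [mul_assoc, hep]
  · rw [← mul_assoc, ← mul_assoc, hqy]

lemma half_step {a : H →L[ℂ] H} (h0 : 0 ≤ a) (h1 : a ≤ 1) :
    ∃ p : H →L[ℂ] H, IsStarProjection p ∧ 0 ≤ a + a - p ∧ a + a - p ≤ 1 ∧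
      ∀ t : H →L[ℂ] H, t * a = a * t → star t * a = a * star t → t * p = p * t := by
  have hasa : IsSelfAdjoint a := IsSelfAdjoint.of_nonneg h0
  have hs0 : ∀ t ∈ spectrum ℝ a, 0 ≤ t := fun t ht => spectrum_nonneg_of_nonneg h0 ht
  have hs1 : ∀ t ∈ spectrum ℝ a, t ≤ 1 :=
    (le_algebraMap_iff_spectrum_le (r := (1 : ℝ)) (a := a) hasa).mp (by simpa using h1)
  set F := cfc (fun t : ℝ => max (t + t - 1) 0) a with hF
  set N := cfc (fun t : ℝ => max (1 - (t + t)) 0) a with hN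
  have hFN : F - N = a + a - 1 := by
    have : a + a - 1 = cfc (fun t : ℝ => t + t - 1) a := by
      rw [cfc_sub _ _ a (by fun_prop) (by fun_prop), cfc_add (R := ℝ) a (fun t => t) (fun t => t) (by fun_prop) (by fun_prop),
        cfc_id' ℝ a, cfc_const_one ℝ a]
    rw [hF, hN, ← cfc_sub _ _ a (by fun_prop) (by fun_prop), this]
    congr 1
    ext t
    rcases le_total (t + t) 1 with ht | ht
    · rw [max_eq_right (by linarith), max_eq_left (by linarith)]; ring
    · rw [max_eq_left (by linarith), max_eq_right (by linarith)]; ring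
  have hNF : N * F = 0 := by
    rw [hF, hN, ← cfc_mul _ _ a (by fun_prop) (by fun_prop), ← cfc_const_zero ℝ a]
    congr 1
    ext t
    rcases le_total (t + t) 1 with ht | ht
    · rw [max_eq_right (a := t + t - 1) (by linarith)]; ring
    · rw [max_eq_right (a := 1 - (t + t)) (by linarith)]; ring
  have hFs : star F = F := (cfc_predicate _ a : IsSelfAdjoint _).star_eq
  have hNs : star N = N := (cfc_predicate _ a : IsSelfAdjoint _).star_eq
  have hF0 : 0 ≤ F := cfc_nonneg (fun t _ => le_max_right _ _)
  have hN0 : 0 ≤ N := cfc_nonneg (fun t _ => le_max_right _ _)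
  have hF1 : F ≤ 1 := cfc_le_one _ _ (fun t ht => max_le (by linarith [hs1 t ht]) zero_le_one)
  have hN1 : N ≤ 1 := cfc_le_one _ _ (fun t ht => max_le (by linarith [hs0 t ht]) zero_le_one)
  obtain ⟨p, hp, hpF, hk, hcomm⟩ := exists_range_proj F
  have hps : star p = p := hp.isSelfAdjoint.star_eq
  have hpp : p * p = p := hp.isIdempotentElem.eq
  have hNp : N * p = 0 := hk N hNF
  have hpN : p * N = 0 := by
    have := congrArg star hNp; rwa [star_mul, hps, hNs, star_zero] at this
  have hFp : F * p = F := by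
    have := congrArg star hpF; rwa [star_mul, hps, hFs] at this
  have e1 : a + a - p = star (1 - p) * (1 - N) * (1 - p) + F := by
    have : a + a = F - N + 1 := by rw [hFN]; abel
    rw [this, star_sub, star_one, hps]
    simp only [sub_mul, mul_sub, one_mul, mul_one, hpN, hNp, hpp, zero_mul]
    abel
  have e2 : 1 - (a + a - p) = star p * (1 - F) * p + N := by
    have : a + a = F - N + 1 := by rw [hFN]; abel
    rw [this, hps]
    simp only [sub_mul, mul_sub, mul_one, hpF, hFp, hpp]
    abel
  refine ⟨p, hp, ?_, ?_, ?_⟩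
  · rw [e1]; exact add_nonneg (star_left_conjugate_nonneg (sub_nonneg.mpr hN1) _) hF0
  · rw [← sub_nonneg, e2]
    exact add_nonneg (star_left_conjugate_nonneg (sub_nonneg.mpr hF1) _) hN0
  · intro t ht ht'
    exact hcomm t (cfc_comm hasa ht _) (cfc_comm hasa ht' _)

/-- The star order. -/
def SLe (v w : H →L[ℂ] H) : Prop := star v * w = star v * v ∧ w * star v = v * star v

lemma SLe.trans' {u v w : H →L[ℂ] H} (hu : u * star u * u = u)
    (h1 : SLe u v) (h2 : SLe v w) : SLe u w := by
  obtain ⟨a1, a2⟩ := h1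
  obtain ⟨b1, b2⟩ := h2
  have hu' : star u * u * star u = star u := by
    have := congrArg star hu; simpa [mul_assoc] using this
  have a1' : star v * u = star u * u := by simpa using congrArg star a1
  have a2' : u * star v = u * star u := by simpa using congrArg star a2
  have c1 : star u * u * star v = star u := by rw [mul_assoc, a2', ← mul_assoc, hu']
  have c2 : star v * u * star u = star u := by rw [a1', hu']
  constructor
  · calc star u * w = star u * u * star v * w := by rw [c1]
      _ = star u * u * (star v * w) := by rw [mul_assoc]
      _ = star u * u * star v * v := by rw [b1, ← mul_assoc]
      _ = star u * u := by rw [c1, a1]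
  · calc w * star u = w * (star v * u * star u) := by rw [c2]
      _ = w * star v * (u * star u) := by simp only [mul_assoc]
      _ = v * (star v * u * star u) := by rw [b2]; simp only [mul_assoc]
      _ = u * star u := by rw [c2, a2]

/-- The set of partial isometries used in maximality arguments. -/
def PI (M : StarSubalgebra ℂ (H →L[ℂ] H)) (p q n : H →L[ℂ] H) (B : Set (H →L[ℂ] H)) :
    Set (H →L[ℂ] H) :=
  {v | v ∈ M ∧ v * star v * v = v ∧ v * p = v ∧ q * v = v ∧ v * n * v = 0 ∧
    ∀ b ∈ B, b * (star v * v) = star v * v * b}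

lemma exists_max_pi {M : StarSubalgebra ℂ (H →L[ℂ] H)} (hM : IsDC M) (p q n : H →L[ℂ] H)
    (B : Set (H →L[ℂ] H)) :
    ∃ v ∈ PI M p q n B, ∀ x, star v * x = 0 → x * star v = 0 → v + x ∈ PI M p q n B → x = 0 := by
  have hz : (0 : H →L[ℂ] H) ∈ PI M p q n B := by
    refine ⟨zero_mem _, ?_, ?_, ?_, ?_, ?_⟩ <;> simp
  let r : PI M p q n B → PI M p q n B → Prop := fun v w => SLe v.1 w.1
  have hrt : ∀ {a b c}, r a b → r b c → r a c := fun {a b c} h1 h2 => SLe.trans' a.2.2.1 h1 h2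
  have hzorn : ∃ m, ∀ a, r m a → r a m := by
    refine exists_maximal_of_chains_bounded ?_ hrt
    intro c hc
    rcases c.eq_empty_or_nonempty with rfl | hne
    · exact ⟨⟨0, hz⟩, by simp⟩
    have htot : ∀ a ∈ c, ∀ b ∈ c, r a b ∨ r b a := by
      intro a ha b hb
      by_cases hab : a = b
      · left; subst hab; exact ⟨rfl, rfl⟩
      · exact hc ha hb hab
    have : Nonempty c := hne.to_subtype
    let F : Filter c := ⨅ v : c, 𝓟 {v' : c | r v.1 v'.1}
    have hF : F.NeBot := by
      refine Filter.iInf_neBot_of_directed' ?_ ?_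
      · intro a b
        rcases htot a.1 a.2 b.1 b.2 with h | h
        · exact ⟨b, principal_mono.mpr fun x hx => hrt h hx, le_rfl⟩
        · exact ⟨a, le_rfl, principal_mono.mpr fun x hx => hrt h hx⟩
      · intro a
        rw [principal_neBot_iff]
        exact ⟨a, rfl, rfl⟩
    let U : Ultrafilter c := Ultrafilter.of F
    have hU : ∀ v : c, ∀ᶠ v' in (U : Filter c), r v.1 v'.1 := fun v =>
      Ultrafilter.of_le F (mem_iInf_of_mem v (mem_principal_self _))
    obtain ⟨w, hw⟩ := wot_limit U (fun v => v.1.1) (fun v => pi_norm _ v.1.2.2.1)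
    have key := fun a b c d k h => wot_eq U (fun v => v.1.1) w hw a b c d k h
    have hle : ∀ v : c, SLe v.1.1 w := by
      intro v
      constructor
      · have := key (star v.1.1) 1 0 0 (star v.1.1 * v.1.1) (by
          filter_upwards [hU v] with v' hv'
          simpa using hv'.1)
        simpa using this
      · have := key 1 (star v.1.1) 0 0 (v.1.1 * star v.1.1) (by
          filter_upwards [hU v] with v' hv'
          simpa using hv'.2)
        simpa using this
    have hwv : ∀ v : c, star w * v.1.1 = star v.1.1 * v.1.1 := fun v => by
      simpa using congrArg star (hle v).1
    have hwv2 : ∀ v : c, w * star v.1.1 = v.1.1 * star v.1.1 := fun v => (hle v).2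
    refine ⟨⟨w, ?_, ?_, ?_, ?_, ?_, ?_⟩, fun a ha => hle ⟨a, ha⟩⟩
    · refine hM w fun t ht => ?_
      have := key t 1 1 t 0 (Eventually.of_forall fun v => by
        simpa using ht _ v.1.2.1)
      simpa using this
    · have := key (w * star w) 1 1 1 0 (Eventually.of_forall fun v => by
        rw [mul_assoc w, hwv, ← mul_assoc, hwv2]
        simpa using v.1.2.2.1)
      simpa using this
    · have := key 1 p 1 1 0 (Eventually.of_forall fun v => by
        simpa using v.1.2.2.2.1)
      simpa using this
    · have := key q 1 1 1 0 (Eventually.of_forall fun v => by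
        simpa using v.1.2.2.2.2.1)
      simpa using this
    · have h1 : ∀ v v' : c, r v.1 v'.1 → v'.1.1 * n * v.1.1 = 0 := by
        intro v v' h
        have e : v.1.1 = v'.1.1 * (star v.1.1 * v.1.1) := by
          rw [← mul_assoc, h.2, v.1.2.2.1]
        rw [e, ← mul_assoc, v'.1.2.2.2.2.2.1, zero_mul]
      have h2 : ∀ v : c, w * n * v.1.1 = 0 := by
        intro v
        have := key 1 (n * v.1.1) 0 0 0 (by
          filter_upwards [hU v] with v' hv'
          simpa [mul_assoc] using h1 v v' hv')
        simpa [mul_assoc] using this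
      have := key (w * n) 1 0 0 0 (Eventually.of_forall fun v => by
        simpa using h2 v)
      simpa using this
    · intro b hb
      have := key (b * star w) 1 (star w) b 0 (Eventually.of_forall fun v => by
        rw [mul_assoc b, hwv]
        simpa using v.1.2.2.2.2.2.2 b hb)
      simpa [mul_assoc] using this
  obtain ⟨m, hm⟩ := hzorn
  refine ⟨m.1, m.2, fun x h1 h2 h3 => ?_⟩
  have := hm ⟨m.1 + x, h3⟩ ⟨by simp [mul_add, h1], by simp [add_mul, h2]⟩
  have h4 := this.1
  have h1' : star x * m.1 = 0 := by simpa using congrArg star h1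
  simp only [star_add, mul_add, add_mul, h1, h1', add_zero] at h4
  have h5 : star x * x = 0 := by simpa using h4
  exact (CStarRing.star_mul_self_eq_zero_iff x).mp h5

lemma central_sep {M : StarSubalgebra ℂ (H →L[ℂ] H)} (hM : IsDC M) {f g : H →L[ℂ] H}
    (hf : IsStarProjection f) (hfM : f ∈ M) (hfg : ∀ x ∈ M, g * x * f = 0)
    (hg : IsStarProjection g) :
    ∃ z ∈ M, IsStarProjection z ∧ (∀ y ∈ M, z * y = y * z) ∧ z * f = f ∧ z * g = 0 := by
  obtain ⟨z, hz, h1, h2, h3⟩ := exists_span_proj' {y | ∃ x ∈ M, y = x * f}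
  refine ⟨z, ?_, hz, ?_, ?_, ?_⟩
  · refine hM z fun t ht => h3 t ?_ ?_
    · rintro _ ⟨x, hx, rfl⟩
      exact ⟨x * f, ⟨x, hx, rfl⟩, t, ht _ (mul_mem hx hfM)⟩
    · rintro _ ⟨x, hx, rfl⟩
      exact ⟨x * f, ⟨x, hx, rfl⟩, star t, comm_star ht _ (mul_mem hx hfM)⟩
  · intro t ht
    refine (h3 t ?_ ?_).symm
    · rintro _ ⟨x, hx, rfl⟩
      exact ⟨t * x * f, ⟨_, mul_mem ht hx, rfl⟩, 1, by simp [mul_assoc]⟩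
    · rintro _ ⟨x, hx, rfl⟩
      exact ⟨star t * x * f, ⟨_, mul_mem (star_mem ht) hx, rfl⟩, 1, by simp [mul_assoc]⟩
  · exact h1 f ⟨1, one_mem _, by simp⟩
  · have h4 : g * z = 0 := h2 g (by
      rintro _ ⟨x, hx, rfl⟩
      rw [← mul_assoc, hfg x hx])
    simpa [hz.isSelfAdjoint.star_eq, hg.isSelfAdjoint.star_eq] using congrArg star h4

/-- support projections of partial isometries -/
lemma pi_initial {v : H →L[ℂ] H} (hv : v * star v * v = v) : IsStarProjection (star v * v) :=
  ⟨by rw [IsIdempotentElem, mul_assoc, ← mul_assoc v, hv], IsSelfAdjoint.star_mul_self v⟩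

lemma pi_star {v : H →L[ℂ] H} (hv : v * star v * v = v) : star v * v * star v = star v := by
  simpa [mul_assoc] using congrArg star hv

lemma pi_final {v : H →L[ℂ] H} (hv : v * star v * v = v) : IsStarProjection (v * star v) := by
  have := pi_initial (v := star v) (by simpa using pi_star hv)
  simpa using this

lemma proj_sub {p q : H →L[ℂ] H} (hp : IsStarProjection p) (hq : IsStarProjection q)
    (h : p * q = q) : IsStarProjection (p - q) := by
  have h' : q * p = q := by
    simpa [hp.isSelfAdjoint.star_eq, hq.isSelfAdjoint.star_eq] using congrArg star h
  refine ⟨?_, hp.isSelfAdjoint.sub hq.isSelfAdjoint⟩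
  rw [IsIdempotentElem, sub_mul, mul_sub, mul_sub, h, h', hp.isIdempotentElem.eq,
    hq.isIdempotentElem.eq]
  abel

/-- sum of partial isometries with orthogonal supports -/
lemma pi_add {u v : H →L[ℂ] H} (hu : u * star u * u = u) (hv : v * star v * v = v)
    (h1 : star u * v = 0) (h2 : v * star u = 0) :
    (u + v) * star (u + v) * (u + v) = u + v ∧
    star (u + v) * (u + v) = star u * u + star v * v ∧
    (u + v) * star (u + v) = u * star u + v * star v := by
  have h1' : star v * u = 0 := by simpa using congrArg star h1
  have h2' : u * star v = 0 := by simpa using congrArg star h2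
  refine ⟨?_, ?_, ?_⟩
  · simp only [star_add, mul_add, add_mul, h2, h2', hu, hv, mul_assoc, h1, h1', mul_zero]
    rw [mul_assoc] at hu hv
    simp [hu, hv]
  · simp [star_add, mul_add, add_mul, h1, h1']
  · simp [star_add, mul_add, add_mul, h2, h2']

lemma comparison {M : StarSubalgebra ℂ (H →L[ℂ] H)} (hM : IsDC M) {p q : H →L[ℂ] H}
    (hp : IsStarProjection p) (hq : IsStarProjection q) (hpM : p ∈ M) (hqM : q ∈ M) :
    ∃ u ∈ M, u * star u * u = u ∧ u * p = u ∧ q * u = u ∧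
      ∃ z ∈ M, IsStarProjection z ∧ (∀ y ∈ M, z * y = y * z) ∧
        z * (p - star u * u) = p - star u * u ∧ z * (q - u * star u) = 0 := by
  obtain ⟨u, ⟨huM, hu, hup, hqu, -, -⟩, hmax⟩ := exists_max_pi hM p q 0 ∅
  refine ⟨u, huM, hu, hup, hqu, ?_⟩
  have hpu : p * star u = star u := by
    simpa [hp.isSelfAdjoint.star_eq] using congrArg star hup
  have huq : star u * q = star u := by
    simpa [hq.isSelfAdjoint.star_eq] using congrArg star hqu
  have hf : IsStarProjection (p - star u * u) :=
    proj_sub hp (pi_initial hu) (by rw [← mul_assoc, hpu])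
  have hg : IsStarProjection (q - u * star u) :=
    proj_sub hq (pi_final hu) (by rw [← mul_assoc, hqu])
  have hfM : p - star u * u ∈ M := sub_mem hpM (mul_mem (star_mem huM) huM)
  have hgM : q - u * star u ∈ M := sub_mem hqM (mul_mem huM (star_mem huM))
  refine central_sep hM hf hfM ?_ hg
  intro x hx
  by_contra hne
  obtain ⟨v, hvM, hv0, hv, hvf, hgv⟩ := exists_pi hM hf hg hfM hgM hx hne
  have h1 : star u * v = 0 := by
    rw [← hgv, ← mul_assoc, mul_sub, huq, ← mul_assoc, pi_star hu, sub_self, zero_mul]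
  have h2 : v * star u = 0 := by
    rw [← hvf, mul_assoc, sub_mul, hpu, pi_star hu, sub_self, mul_zero]
  refine hv0 (hmax v h1 h2 ⟨add_mem huM hvM, (pi_add hu hv h1 h2).1, ?_, ?_, by simp, by simp⟩)
  · rw [add_mul, hup]
    congr 1
    rw [← hvf, mul_assoc, sub_mul, hp.isIdempotentElem.eq, mul_assoc, hup]
  · rw [mul_add, hqu]
    congr 1
    rw [← hgv, ← mul_assoc, mul_sub, hq.isIdempotentElem.eq, ← mul_assoc, hqu]

/-- Masa data. -/
structure IsMasa (M A : StarSubalgebra ℂ (H →L[ℂ] H)) : Prop where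
  le : ∀ a ∈ A, a ∈ M
  comm : ∀ a ∈ A, ∀ b ∈ A, a * b = b * a
  mem : ∀ x ∈ M, (∀ a ∈ A, a * x = x * a) → x ∈ A

lemma spec {M A : StarSubalgebra ℂ (H →L[ℂ] H)} (hM : IsDC M) (hA : IsMasa M A)
    (x : H →L[ℂ] H) (hx : ∀ p ∈ A, IsStarProjection p → p * x = x * p) :
    ∀ a ∈ A, a * x = x * a := by
  have hbound : ∀ n : ℕ, ∀ a ∈ A, 0 ≤ a → a ≤ 1 → ‖a * x - x * a‖ ≤ (2 * ‖x‖) / 2 ^ n := by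
    intro n
    induction n with
    | zero =>
      intro a ha h0 h1
      have hn : ‖a‖ ≤ 1 := (CStarAlgebra.norm_le_one_iff_of_nonneg a h0).mpr h1
      calc ‖a * x - x * a‖ ≤ ‖a * x‖ + ‖x * a‖ := norm_sub_le _ _
        _ ≤ ‖a‖ * ‖x‖ + ‖x‖ * ‖a‖ := add_le_add (norm_mul_le _ _) (norm_mul_le _ _)
        _ ≤ 2 * ‖x‖ / 2 ^ 0 := by
          rw [pow_zero, div_one]; nlinarith [norm_nonneg x]
    | succ n ih =>
      intro a ha h0 h1
      obtain ⟨p, hp, hp0, hp1, hpc⟩ := half_step h0 h1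
      have hpM : p ∈ M := hM p fun t ht => hpc t (ht a (hA.le a ha)) (comm_star ht a (hA.le a ha))
      have hpA : p ∈ A := hA.mem p hpM fun b hb =>
        hpc b (hA.comm b hb a ha) (hA.comm _ (star_mem hb) a ha)
      have h := ih (a + a - p) (sub_mem (add_mem ha ha) hpA) hp0 hp1
      have e : (a + a - p) * x - x * (a + a - p) = (2 : ℝ) • (a * x - x * a) := by
        rw [two_smul, sub_mul, mul_sub, add_mul, mul_add, hx p hpA hp]
        abel
      rw [e, norm_smul, Real.norm_of_nonneg zero_le_two] at h
      rw [pow_succ, ← div_div]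
      linarith
  have hpos : ∀ a ∈ A, 0 ≤ a → a ≤ 1 → a * x = x * a := by
    intro a ha h0 h1
    have hlim : Tendsto (fun n : ℕ => (2 * ‖x‖) / 2 ^ n) atTop (𝓝 0) := by
      have := (tendsto_pow_atTop_nhds_zero_of_lt_one (r := (1 / 2 : ℝ)) (by norm_num)
        (by norm_num)).const_mul (2 * ‖x‖)
      simpa [div_eq_mul_inv] using this
    have := ge_of_tendsto' hlim fun n => hbound n a ha h0 h1
    exact sub_eq_zero.mp (norm_le_zero_iff.mp this)
  have hsa : ∀ a ∈ A, IsSelfAdjoint a → a * x = x * a := by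
    intro a ha hs
    have hnn : ∀ b ∈ A, 0 ≤ b → b * x = x * b := by
      intro b hb h0
      have hK : 0 < ‖b‖ + 1 := by positivity
      have hb' : (‖b‖ + 1)⁻¹ • b ∈ A := by
        have : (‖b‖ + 1)⁻¹ • b = (((‖b‖ + 1)⁻¹ : ℝ) : ℂ) • b := by
          rw [Complex.coe_smul]
        rw [this]; exact A.smul_mem hb _
      have h0' : 0 ≤ (‖b‖ + 1)⁻¹ • b := smul_nonneg (by positivity) h0
      have h1' : (‖b‖ + 1)⁻¹ • b ≤ 1 := by
        rw [← CStarAlgebra.norm_le_one_iff_of_nonneg _ h0', norm_smul,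
          Real.norm_of_nonneg (by positivity), inv_mul_le_one₀ hK]
        linarith
      have h := hpos _ hb' h0' h1'
      rw [smul_mul_assoc, mul_smul_comm] at h
      exact smul_right_injective _ (inv_ne_zero hK.ne') h
    have hm : algebraMap ℝ (H →L[ℂ] H) ‖a‖ ∈ A := by
      have : algebraMap ℝ (H →L[ℂ] H) ‖a‖ = algebraMap ℂ (H →L[ℂ] H) ((‖a‖ : ℝ) : ℂ) := by
        rw [Algebra.algebraMap_eq_smul_one, Algebra.algebraMap_eq_smul_one, Complex.coe_smul]
      rw [this]; exact A.algebraMap_mem _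
    have h := hnn (a + algebraMap ℝ (H →L[ℂ] H) ‖a‖) (add_mem ha hm) (by
      have := hs.neg_algebraMap_norm_le_self
      rwa [neg_le_iff_add_nonneg] at this)
    rw [add_mul, mul_add, Algebra.commutes] at h
    exact add_right_cancel h
  intro a ha
  have e : (2 : ℂ) • a = (a + star a) - Complex.I • (Complex.I • (a - star a)) := by
    rw [smul_smul, Complex.I_mul_I, two_smul, neg_one_smul]; abel
  have h1 := hsa (a + star a) (add_mem ha (star_mem ha)) (IsSelfAdjoint.add_star_self a)
  have h2 := hsa (Complex.I • (a - star a)) (A.smul_mem (sub_mem ha (star_mem ha)) _) (by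
    rw [IsSelfAdjoint, star_smul]; simp [← smul_neg])
  have h3 : ((2 : ℂ) • a) * x = x * ((2 : ℂ) • a) := by
    rw [e, sub_mul, mul_sub, h1, smul_mul_assoc, h2, ← mul_smul_comm]
  rw [smul_mul_assoc, mul_smul_comm] at h3
  exact smul_right_injective _ (two_ne_zero' ℂ) h3

/-- Faithful trace data. -/
structure IsTr (M : StarSubalgebra ℂ (H →L[ℂ] H)) (τ : (H →L[ℂ] H) →ₗ[ℂ] ℂ) : Prop where
  tr : ∀ x ∈ M, ∀ y ∈ M, τ (x * y) = τ (y * x)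
  pos : ∀ x ∈ M, 0 ≤ (τ (star x * x)).re ∧ (τ (star x * x)).im = 0
  faithful : ∀ x ∈ M, τ (star x * x) = 0 → x = 0

lemma proj_eq {p : H →L[ℂ] H} (hp : IsStarProjection p) : star p * p = p := by
  rw [hp.isSelfAdjoint.star_eq, hp.isIdempotentElem.eq]

section tr
variable {M A : StarSubalgebra ℂ (H →L[ℂ] H)} {τ : (H →L[ℂ] H) →ₗ[ℂ] ℂ}

lemma tr_proj (hτ : IsTr M τ) {p : H →L[ℂ] H} (hp : IsStarProjection p) (hpM : p ∈ M) :
    0 ≤ (τ p).re := by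
  have := (hτ.pos p hpM).1
  rwa [proj_eq hp] at this

lemma fin (hτ : IsTr M τ) {u : H →L[ℂ] H} (huM : u ∈ M) (hu : u * star u * u = u)
    (h : star u * u * (u * star u) = u * star u) : u * star u = star u * u := by
  have hd := proj_sub (pi_initial hu) (pi_final hu) h
  have hdM : star u * u - u * star u ∈ M :=
    sub_mem (mul_mem (star_mem huM) huM) (mul_mem huM (star_mem huM))
  have := hτ.faithful _ hdM (by
    rw [proj_eq hd, map_sub, hτ.tr _ huM _ (star_mem huM), sub_self])
  exact (sub_eq_zero.mp this).symm

/-- cutting a partial isometry by a central projection -/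
lemma pi_cut {z u : H →L[ℂ] H} (hz : IsStarProjection z) (hzu : z * u = u * z)
    (hu : u * star u * u = u) :
    (z * u) * star (z * u) * (z * u) = z * u ∧ star (z * u) * (z * u) = z * (star u * u) ∧
      (z * u) * star (z * u) = z * (u * star u) := by
  have hzs := hz.isSelfAdjoint.star_eq
  have hzz := hz.isIdempotentElem.eq
  have hzu' : z * star u = star u * z := by
    have := congrArg star hzu; simpa [hzs] using this.symm
  have e1 : star (z * u) * (z * u) = z * (star u * u) := by
    rw [star_mul, hzs, mul_assoc, ← mul_assoc z z, hzz, ← mul_assoc, ← hzu', mul_assoc]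
  have e2 : (z * u) * star (z * u) = z * (u * star u) := by
    rw [star_mul, hzs, ← hzu', mul_assoc, ← mul_assoc u, ← hzu, ← mul_assoc, ← mul_assoc, hzz,
      mul_assoc]
  refine ⟨?_, e1, e2⟩
  rw [e2, mul_assoc, mul_assoc u, ← mul_assoc (star u), ← hzu', mul_assoc z, ← mul_assoc u,
    ← hzu, mul_assoc z, ← mul_assoc z, hzz, ← mul_assoc u, hu]

lemma kstep (hM : IsDC M) (hA : IsMasa M A) (hτ : IsTr M τ) {s a : H →L[ℂ] H}
    (hs : IsStarProjection s) (hsM : s ∈ M) (ha : IsStarProjection a)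
    (hH : ∀ v ∈ M, v * star v * v = v → star v * v ∈ A → v * a = v → s * v = v → v = 0)
    {e : H →L[ℂ] H} (he : IsStarProjection e) (heA : e ∈ A) (hae : a * e = e)
    {y : H →L[ℂ] H} (hyM : y ∈ M) (hy : star y * y = s) (hey : e * y = y) :
    ∃ e1 ∈ A, IsStarProjection e1 ∧ a * e1 = e1 ∧ (∃ y ∈ M, star y * y = s ∧ e1 * y = y) ∧
      2 * (τ e1).re ≤ (τ e).re := by
  have hes := he.isSelfAdjoint.star_eq
  have hee := he.isIdempotentElem.eq
  have hss := hs.isSelfAdjoint.star_eq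
  have hs2 := hs.isIdempotentElem.eq
  have hea : e * a = e := by
    simpa [hes, ha.isSelfAdjoint.star_eq] using congrArg star hae
  have hcent : ∀ z ∈ M, (∀ y ∈ M, z * y = y * z) → z ∈ A := fun z hz h =>
    hA.mem z hz fun b hb => (h b (hA.le b hb)).symm
  obtain ⟨x, ⟨hxM, hx, hxe, hex, hxx, hxc⟩, hmax⟩ := exists_max_pi hM e e 1 (A : Set (H →L[ℂ] H))
  rw [mul_one] at hxx
  have hex' : e * star x = star x := by simpa [hes] using congrArg star hxe
  have hxe' : star x * e = star x := by simpa [hes] using congrArg star hex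
  have he1M : star x * x ∈ M := mul_mem (star_mem hxM) hxM
  have he1A : star x * x ∈ A := hA.mem _ he1M hxc
  have he1 := pi_initial hx
  have hee1 : e * (star x * x) = star x * x := by rw [← mul_assoc, hex']
  have he1e : star x * x * e = star x * x := by rw [mul_assoc, hxe]
  have hae1 : a * (star x * x) = star x * x := by
    rw [← hee1, ← mul_assoc, hae]
  have htr : 2 * (τ (star x * x)).re ≤ (τ e).re := by
    have h1 := proj_sub he he1 hee1
    have h2 := proj_sub h1 (pi_final hx) (by
      rw [sub_mul, ← mul_assoc, hex, mul_assoc, ← mul_assoc x x, hxx, zero_mul, mul_zero, sub_zero])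
    have h3 := tr_proj hτ h2 (sub_mem (sub_mem (hA.le e heA) he1M) (mul_mem hxM (star_mem hxM)))
    rw [map_sub, map_sub, hτ.tr x hxM _ (star_mem hxM)] at h3
    simp only [Complex.sub_re] at h3
    linarith
  obtain ⟨y0, hy0M, hy0, hy0s, he1y0, z, hzM, hz, hzc, hz1, hz2⟩ :=
    comparison hM hs he1 hsM he1M
  have hzs := hz.isSelfAdjoint.star_eq
  have hzz := hz.isIdempotentElem.eq
  have hzA := hcent z hzM hzc
  by_cases hs0 : s - star y0 * y0 = 0
  · exact ⟨_, he1A, he1, hae1, ⟨y0, hy0M, (sub_eq_zero.mp hs0).symm, he1y0⟩, htr⟩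
  exfalso
  apply hs0
  have hsy0 : s * star y0 = star y0 := by simpa [hss] using congrArg star hy0s
  have hze1 : z * (star x * x) = z * (y0 * star y0) := by
    rw [mul_sub] at hz2; exact sub_eq_zero.mp hz2
  have hze0 : z * (star x * x) = 0 := by
    obtain ⟨c1, c2, c3⟩ := pi_cut hz (hzc _ (star_mem hy0M))
      (show star y0 * star (star y0) * star y0 = star y0 by simpa using pi_star hy0)
    have h0 := hH (z * star y0) (mul_mem hzM (star_mem hy0M)) c1
      (by rw [c2, star_star, ← hze1]; exact mul_mem hzA he1A)
      (by
        have : star y0 * a = star y0 := by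
          have h1 : star y0 * (star x * x) = star y0 := by
            simpa [he1.isSelfAdjoint.star_eq] using congrArg star he1y0
          rw [← h1, ← he1e, mul_assoc, mul_assoc _ e a, hea]
        rw [mul_assoc, this])
      (by rw [← mul_assoc, ← hzc s hsM, mul_assoc, hsy0])
    have c2' : star (z * star y0) * (z * star y0) = z * (y0 * star y0) := by rw [c2, star_star]
    rw [hze1, ← c2', h0]
    simp
  have hzx : z * x = 0 := by
    have : z * x = x * (z * (star x * x)) := by
      rw [← mul_assoc, ← hzc x hxM, mul_assoc, ← mul_assoc x, hx]
    rw [this, hze0, mul_zero]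
  have hxz : x * z = 0 := by rw [← hzc x hxM, hzx]
  have hzx' : z * star x = 0 := by simpa [hzs] using congrArg star hxz
  have hxz' : star x * z = 0 := by simpa [hzs] using congrArg star hzx
  -- new partial isometries under `z * e`
  have hnew : ∀ v ∈ M, v * star v * v = v → star v * v ∈ A → z * v = v → v * e = v → e * v = v →
      v * v = 0 → v = 0 := by
    intro v hvM hv hvA hzv hve hev hvv
    have hvz : v * z = v := by rw [← hzc v hvM, hzv]
    have h1 : star x * v = 0 := by rw [← hzv, ← mul_assoc, hxz', zero_mul]
    have h2 : v * star x = 0 := by rw [← hvz, mul_assoc, hzx', mul_zero]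
    have h3 : x * v = 0 := by rw [← hzv, ← mul_assoc, hxz, zero_mul]
    have h4 : v * x = 0 := by rw [← hvz, mul_assoc, hzx, mul_zero]
    obtain ⟨d1, d2, d3⟩ := pi_add hx hv h1 h2
    refine hmax v h1 h2 ⟨add_mem hxM hvM, d1, by rw [add_mul, hxe, hve],
      by rw [mul_add, hex, hev], ?_, ?_⟩
    · simp [mul_add, add_mul, hxx, hvv, h3, h4]
    · intro b hb
      rw [d2]
      exact hA.comm b hb _ (add_mem he1A hvA)
  have hgA : z * e ∈ A := mul_mem hzA heA
  have hgM := hA.le _ hgA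
  have hze := hA.comm z hzA e heA
  have hg : IsStarProjection (z * e) := by
    refine ⟨?_, ?_⟩
    · rw [IsIdempotentElem, mul_assoc, ← mul_assoc e, ← hze, mul_assoc, hee, ← mul_assoc, hzz]
    · rw [IsSelfAdjoint, star_mul, hes, hzs, hze]
  have hgg := hg.isIdempotentElem.eq
  have hgs := hg.isSelfAdjoint.star_eq
  have hcorner : ∀ p ∈ A, IsStarProjection p → ∀ t ∈ M,
      (z * e - p * (z * e)) * t * (p * (z * e)) = 0 := by
    intro p hpA hp t ht
    have hps := hp.isSelfAdjoint.star_eq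
    have hpp := hp.isIdempotentElem.eq
    have hpg := hA.comm p hpA _ hgA
    have hzg : z * (z * e) = z * e := by rw [← mul_assoc, hzz]
    have heg : e * (z * e) = z * e := by rw [hze, ← mul_assoc, hee]
    have hge : z * e * e = z * e := by rw [mul_assoc, hee]
    set g := z * e with hgdef
    clear_value g
    have hp1A : p * g ∈ A := mul_mem hpA hgA
    have hp1 : IsStarProjection (p * g) := by
      refine ⟨?_, ?_⟩
      · rw [IsIdempotentElem, mul_assoc, ← mul_assoc g, ← hpg, mul_assoc, hgg, ← mul_assoc, hpp]
      · rw [IsSelfAdjoint, star_mul, hgs, hps, hpg]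
    have hgp1 : g * (p * g) = p * g := by rw [← mul_assoc, ← hpg, mul_assoc, hgg]
    have hq1A : g - p * g ∈ A := sub_mem hgA hp1A
    have hq1 : IsStarProjection (g - p * g) := proj_sub hg hp1 hgp1
    set p1 := p * g with hp1def
    set q1 := g - p1 with hq1def
    clear_value q1 p1
    have hgq1 : g * q1 = q1 := by rw [hq1def, mul_sub, hgg, hgp1]
    have hp1g : p1 * g = p1 := by rw [hp1def, mul_assoc, hgg]
    have hq1g : q1 * g = q1 := by rw [hq1def, sub_mul, hgg, hp1g]
    have hp1q1 : p1 * q1 = 0 := by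
      rw [hq1def, mul_sub, hp1g, hp1.isIdempotentElem.eq, sub_self]
    have hq1p1 : q1 * p1 = 0 := by
      rw [hq1def, sub_mul, hgp1, hp1.isIdempotentElem.eq, sub_self]
    obtain ⟨u, huM, hu, hup, hqu, c, hcM, hc, hcc, hc1, hc2⟩ :=
      comparison hM hp1 hq1 (hA.le _ hp1A) (hA.le _ hq1A)
    have hcA := hcent c hcM hcc
    have hug : u * g = u := by rw [← hup, mul_assoc, hp1g]
    have hgu : g * u = u := by rw [← hqu, ← mul_assoc, hgq1]
    have huu : u * u = 0 := by
      calc u * u = (u * p1) * (q1 * u) := by rw [hup, hqu]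
        _ = u * (p1 * q1) * u := by simp only [mul_assoc]
        _ = 0 := by rw [hp1q1, mul_zero, zero_mul]
    have hze_u : z * u = u := by rw [← hgu, ← mul_assoc, hzg]
    have heu : e * u = u := by rw [← hgu, ← mul_assoc, heg]
    have hue : u * e = u := by rw [← hug, mul_assoc, hge]
    have hus : star u * star u = 0 := by simpa using congrArg star huu
    have heus : e * star u = star u := by simpa [hes] using congrArg star hue
    have hues : star u * e = star u := by simpa [hes] using congrArg star heu
    have hzus : z * star u = star u := by
      rw [hzc _ (star_mem huM)]; simpa [hzs] using congrArg star hze_u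
    have hc' : IsStarProjection (1 - c) := hc.one_sub
    have hc'c : ∀ y ∈ M, (1 - c) * y = y * (1 - c) := by
      intro y hy; rw [sub_mul, mul_sub, hcc y hy, one_mul, mul_one]
    have hc'M : 1 - c ∈ M := sub_mem (one_mem _) hcM
    have u1 : (1 - c) * u = 0 := by
      obtain ⟨k1, k2, k3⟩ := pi_cut hc' (hc'c u huM) hu
      refine hnew _ (mul_mem hc'M huM) k1 ?_ ?_ ?_ ?_ ?_
      · have : (1 - c) * (star u * u) = (1 - c) * p1 := by
          rw [mul_sub] at hc1
          rw [sub_mul, sub_mul, one_mul, one_mul]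
          rw [sub_eq_sub_iff_add_eq_add] at hc1 ⊢
          rw [add_comm, hc1]
        rw [k2, this]
        exact mul_mem (sub_mem (one_mem _) hcA) hp1A
      · rw [← mul_assoc, hzc _ hc'M, mul_assoc, hze_u]
      · rw [mul_assoc, hue]
      · rw [← mul_assoc, ← hc'c e (hA.le e heA), mul_assoc, heu]
      · rw [hc'c u huM, mul_assoc, ← mul_assoc (1 - c), hc'c u huM, mul_assoc u, ← mul_assoc u u,
          huu, zero_mul]
    have u2 : c * star u = 0 := by
      obtain ⟨k1, k2, k3⟩ := pi_cut hc (hcc _ (star_mem huM))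
        (show star u * star (star u) * star u = star u by simpa using pi_star hu)
      refine hnew _ (mul_mem hcM (star_mem huM)) k1 ?_ ?_ ?_ ?_ ?_
      · have : c * (u * star u) = c * q1 := by
          rw [mul_sub] at hc2
          exact (sub_eq_zero.mp hc2).symm
        rw [k2, star_star, this]
        exact mul_mem hcA hq1A
      · rw [← mul_assoc, hzc _ hcM, mul_assoc, hzus]
      · rw [mul_assoc, hues]
      · rw [← mul_assoc, ← hcc e (hA.le e heA), mul_assoc, heus]
      · rw [hcc _ (star_mem huM), mul_assoc, ← mul_assoc c, hcc _ (star_mem huM),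
          mul_assoc (star u), ← mul_assoc (star u) (star u), hus, zero_mul]
    have u3 : c * u = 0 := by
      rw [hcc u huM]
      simpa [hc.isSelfAdjoint.star_eq] using congrArg star u2
    have u0 : u = 0 := by
      rw [sub_mul, u3, one_mul, sub_zero] at u1; exact u1
    rw [u0] at hc1 hc2
    simp only [star_zero, mul_zero, sub_zero] at hc1 hc2
    rw [← hc1, mul_assoc, ← mul_assoc t, ← hcc t ht, ← mul_assoc, ← mul_assoc,
      ← hcc q1 (hA.le _ hq1A), hc2, zero_mul, zero_mul]
  have hcomm : ∀ t ∈ M, (z * e) * t * (z * e) ∈ A := by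
    intro t ht
    refine hA.mem _ (mul_mem (mul_mem hgM ht) hgM) (spec hM hA _ ?_)
    intro p hpA hp
    have hps := hp.isSelfAdjoint.star_eq
    have hpg := hA.comm p hpA _ hgA
    have h1 := hcorner p hpA hp t ht
    have h2 := congrArg star (hcorner p hpA hp (star t) (star_mem ht))
    simp only [star_mul, star_sub, star_star, hgs, hps, star_zero] at h2
    set g := z * e
    clear_value g
    rw [sub_mul, sub_mul, sub_eq_zero] at h1
    rw [← hpg, ← mul_assoc, mul_sub, sub_eq_zero, ← mul_assoc] at h2
    rw [← mul_assoc, ← mul_assoc, h2, mul_assoc (g * t), ← hpg, h1]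
    simp only [mul_assoc]
  -- conclude
  have hs0p := proj_sub hs (pi_initial hy0) (by rw [← mul_assoc, hsy0])
  have hs0M : s - star y0 * y0 ∈ M := sub_mem hsM (mul_mem (star_mem hy0M) hy0M)
  have hss0 : s * (s - star y0 * y0) = s - star y0 * y0 := by
    rw [mul_sub, hs2, ← mul_assoc, hsy0]
  set s0 := s - star y0 * y0 with hs0def
  have hs0s := hs0p.isSelfAdjoint.star_eq
  have hs02 := hs0p.isIdempotentElem.eq
  have hwM : y * s0 ∈ M := mul_mem hyM hs0M
  have hw1 : star (y * s0) * (y * s0) = s0 := by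
    rw [star_mul, mul_assoc, ← mul_assoc (star y), hy, hss0, hs0s, hs02]
  have hgw : (z * e) * (y * s0) = y * s0 := by
    rw [mul_assoc, ← mul_assoc e, hey, ← mul_assoc, hzc y hyM, mul_assoc, hz1]
  have hwg : star (y * s0) * (z * e) = star (y * s0) := by
    have := congrArg star hgw
    rwa [star_mul, hgs] at this
  have hw2 : (y * s0) * star (y * s0) ∈ A := by
    have := hcomm _ (mul_mem hwM (star_mem hwM))
    have e2 : (z * e) * ((y * s0) * star (y * s0)) * (z * e) = (y * s0) * star (y * s0) := by
      rw [← mul_assoc (z * e), hgw, mul_assoc (y * s0), hwg]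
    rwa [e2] at this
  have hw0 := hH (star (y * s0)) (star_mem hwM)
    (by rw [star_star, hw1, star_mul, ← mul_assoc, hs0s, hs02])
    (by rw [star_star]; exact hw2)
    (by rw [← hwg, mul_assoc, mul_assoc z, hea])
    (by rw [star_mul, hs0s, ← mul_assoc, hss0])
  rw [hw0, zero_mul] at hw1
  exact hw1.symm

lemma klemma (hM : IsDC M) (hA : IsMasa M A) (hτ : IsTr M τ) {s a t : H →L[ℂ] H}
    (hs : IsStarProjection s) (hsM : s ∈ M) (ha : IsStarProjection a) (haA : a ∈ A)
    (ht : t ∈ M) (hne : a * t * s ≠ 0) :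
    ∃ v ∈ M, v ≠ 0 ∧ v * star v * v = v ∧ star v * v ∈ A ∧ v * a = v ∧ s * v = v := by
  by_contra hcon
  push Not at hcon
  obtain ⟨y, hyM, hy0, hy, hys, hay⟩ := exists_pi hM hs ha hsM (hA.le a haA) ht hne
  have hsy : s * star y = star y := by
    simpa [hs.isSelfAdjoint.star_eq] using congrArg star hys
  have hH : ∀ v ∈ M, v * star v * v = v → star v * v ∈ A → v * a = v →
      (star y * y) * v = v → v = 0 := by
    intro v hvM hv hvA hva hsv
    by_contra hv0
    refine hcon v hvM hv0 hv hvA hva ?_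
    rw [← hsv, ← mul_assoc, ← mul_assoc, hsy]
  have hs' := pi_initial hy
  have hs'M : star y * y ∈ M := mul_mem (star_mem hyM) hyM
  have hiter : ∀ n : ℕ, ∃ e ∈ A, IsStarProjection e ∧ a * e = e ∧
      (∃ w ∈ M, star w * w = star y * y ∧ e * w = w) ∧ (τ e).re ≤ (τ a).re / 2 ^ n := by
    intro n
    induction n with
    | zero => exact ⟨a, haA, ha, ha.isIdempotentElem.eq, ⟨y, hyM, rfl, hay⟩, by simp⟩
    | succ n ih =>
      obtain ⟨e, heA, he, hae, ⟨w, hwM, hw, hew⟩, hle⟩ := ih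
      obtain ⟨e1, he1A, he1, hae1, hw1, hle1⟩ :=
        kstep hM hA hτ hs' hs'M ha hH he heA hae hwM hw hew
      refine ⟨e1, he1A, he1, hae1, hw1, ?_⟩
      rw [pow_succ, ← div_div]
      linarith
  have hle : ∀ n : ℕ, (τ (star y * y)).re ≤ (τ a).re / 2 ^ n := by
    intro n
    obtain ⟨e, heA, he, hae, ⟨w, hwM, hw, hew⟩, hle⟩ := hiter n
    refine le_trans ?_ hle
    have hwpi : w * star w * w = w := by
      have hd : star (w * star w * w - w) * (w * star w * w - w) = 0 := by
        have h2 : star w * w * (star w * w) = star w * w := by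
          rw [hw]; exact hs'.isIdempotentElem.eq
        have h3 : star w * (w * (star w * w)) = star w * w := by rw [← mul_assoc, h2]
        simp only [star_sub, star_mul, star_star, sub_mul, mul_sub, mul_assoc, h3]
        simp
      exact sub_eq_zero.mp ((CStarRing.star_mul_self_eq_zero_iff _).mp hd)
    have h4 := tr_proj hτ (proj_sub he (pi_final hwpi) (by rw [← mul_assoc, hew]))
      (sub_mem (hA.le e heA) (mul_mem hwM (star_mem hwM)))
    rw [map_sub, hτ.tr w hwM _ (star_mem hwM), hw, Complex.sub_re] at h4
    linarith
  have hlim : Tendsto (fun n : ℕ => (τ a).re / 2 ^ n) atTop (𝓝 0) := by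
    have := (tendsto_pow_atTop_nhds_zero_of_lt_one (r := (1 / 2 : ℝ)) (by norm_num)
      (by norm_num)).const_mul ((τ a).re)
    simpa [div_eq_mul_inv] using this
  have h0 := ge_of_tendsto' hlim hle
  obtain ⟨hp1, hp2⟩ := hτ.pos y hyM
  exact hy0 (hτ.faithful y hyM (Complex.ext (le_antisymm h0 hp1) hp2))

lemma kadison (hM : IsDC M) (hA : IsMasa M A) (hτ : IsTr M τ) {s : H →L[ℂ] H}
    (hs : IsStarProjection s) (hsM : s ∈ M) :
    ∃ x ∈ M, x * star x * x = x ∧ x * star x = s ∧ star x * x ∈ A := by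
  obtain ⟨x, ⟨hxM, hx, -, hsx, -, hxc⟩, hmax⟩ := exists_max_pi hM 1 s 0 (A : Set (H →L[ℂ] H))
  have hxA : star x * x ∈ A := hA.mem _ (mul_mem (star_mem hxM) hxM) hxc
  refine ⟨x, hxM, hx, ?_, hxA⟩
  have hxs : star x * s = star x := by
    simpa [hs.isSelfAdjoint.star_eq] using congrArg star hsx
  have hf := proj_sub hs (pi_final hx) (by rw [← mul_assoc, hsx])
  have hfM : s - x * star x ∈ M := sub_mem hsM (mul_mem hxM (star_mem hxM))
  have ha : IsStarProjection (1 - star x * x) := (pi_initial hx).one_sub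
  have haA : 1 - star x * x ∈ A := sub_mem (one_mem _) hxA
  have hzero : ∀ t ∈ M, (1 - star x * x) * t * (s - x * star x) = 0 := by
    intro t ht
    by_contra hne
    obtain ⟨v, hvM, hv0, hv, hvA, hva, hfv⟩ := klemma hM hA hτ hf hfM ha haA ht hne
    have h1 : star x * v = 0 := by
      rw [← hfv, ← mul_assoc, mul_sub, hxs, ← mul_assoc, pi_star hx, sub_self, zero_mul]
    have h2 : v * star x = 0 := by
      rw [← hva, mul_assoc, sub_mul, one_mul, pi_star hx, sub_self, mul_zero]
    obtain ⟨d1, d2, d3⟩ := pi_add hx hv h1 h2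
    refine hv0 (hmax v h1 h2 ⟨add_mem hxM hvM, d1, mul_one _, ?_, by simp, ?_⟩)
    · rw [mul_add, hsx]
      congr 1
      rw [← hfv, ← mul_assoc, mul_sub, hs.isIdempotentElem.eq, ← mul_assoc, hsx]
    · intro b hb
      rw [d2]
      exact hA.comm b hb _ (add_mem hxA hvA)
  obtain ⟨z, hzM, hz, hzc, hzf, hza⟩ := central_sep hM hf hfM hzero ha
  have hz1 : z * (star x * x) = z := by
    rw [mul_sub, mul_one, sub_eq_zero] at hza; exact hza.symm
  obtain ⟨k1, k2, k3⟩ := pi_cut hz (hzc x hxM) hx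
  have hfin := fin hτ (mul_mem hzM hxM) k1 (by
    rw [k2, k3, hz1, ← mul_assoc, hz.isIdempotentElem.eq])
  rw [k2, k3, hz1] at hfin
  have h0 : s - x * star x = 0 := by
    have h3 : x * star x * (s - x * star x) = 0 := by
      rw [mul_sub, mul_assoc, hxs, (pi_final hx).isIdempotentElem.eq, sub_self]
    rw [← hzf, ← hfin, mul_assoc, h3, mul_zero]
  exact (sub_eq_zero.mp h0).symm

/-- A unitary of `M` conjugating the projection `s` into `A`. -/
lemma conj_unitary (hM : IsDC M) (hA : IsMasa M A) (hτ : IsTr M τ) {s : H →L[ℂ] H}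
    (hs : IsStarProjection s) (hsM : s ∈ M) :
    ∃ W ∈ M, star W * W = 1 ∧ W * star W = 1 ∧ star W * s * W ∈ A := by
  obtain ⟨x, hxM, hx, hxs, hxA⟩ := kadison hM hA hτ hs hsM
  have hp := pi_initial hx
  have hpM := hA.le _ hxA
  have hp' : IsStarProjection (1 - star x * x) := hp.one_sub
  have hs' : IsStarProjection (1 - s) := hs.one_sub
  obtain ⟨u, huM, hu, hup, hqu, z, hzM, hz, hzc, hz1, hz2⟩ :=
    comparison hM hp' hs' (sub_mem (one_mem _) hpM) (sub_mem (one_mem _) hsM)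
  have hsx : s * x = x := by rw [← hxs, hx]
  have hxs' : star x * s = star x := by
    simpa [hs.isSelfAdjoint.star_eq] using congrArg star hsx
  have hsu : s * u = 0 := by
    rw [← hqu, ← mul_assoc, mul_sub, mul_one, hs.isIdempotentElem.eq, sub_self, zero_mul]
  have h1 : star x * u = 0 := by rw [← hxs', mul_assoc, hsu, mul_zero]
  have h2 : u * star x = 0 := by
    rw [← hup, mul_assoc, sub_mul, one_mul, pi_star hx, sub_self, mul_zero]
  obtain ⟨d1, d2, d3⟩ := pi_add hx hu h1 h2
  rw [hxs] at d3
  set W := x + u with hW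
  have hWM : W ∈ M := add_mem hxM huM
  have hf : 1 - star x * x - star u * u = 1 - star W * W := by rw [d2]; abel
  have hg : 1 - s - u * star u = 1 - W * star W := by rw [d3]; abel
  rw [hf] at hz1
  rw [hg] at hz2
  have hzz := hz.isIdempotentElem.eq
  have hz' : IsStarProjection (1 - z) := hz.one_sub
  have hz'c : ∀ y ∈ M, (1 - z) * y = y * (1 - z) := by
    intro y hy; rw [sub_mul, mul_sub, hzc y hy, one_mul, mul_one]
  have f1 : z * (W * star W) = z := by
    rw [mul_sub, mul_one, sub_eq_zero] at hz2; exact hz2.symm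
  have f2 : (1 - z) * (star W * W) = 1 - z := by
    rw [mul_sub, mul_one] at hz1
    rw [sub_mul, one_mul]
    rw [sub_eq_sub_iff_add_eq_add] at hz1 ⊢
    rw [add_comm, ← hz1]
  have g1 : z * (star W * W) = z := by
    obtain ⟨k1, k2, k3⟩ := pi_cut hz (hzc _ (star_mem hWM))
      (show star W * star (star W) * star W = star W by simpa using pi_star d1)
    rw [star_star] at k2 k3
    have := fin hτ (mul_mem hzM (star_mem hWM)) k1 (by
      rw [k2, k3, f1, ← mul_assoc, hzz])
    rw [k2, k3, f1] at this
    exact this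
  have g2 : (1 - z) * (W * star W) = 1 - z := by
    obtain ⟨k1, k2, k3⟩ := pi_cut hz' (hz'c _ hWM) d1
    have := fin hτ (mul_mem (sub_mem (one_mem _) hzM) hWM) k1 (by
      rw [k2, k3, f2, ← mul_assoc, hz'.isIdempotentElem.eq])
    rw [k2, k3, f2] at this
    exact this
  refine ⟨W, hWM, ?_, ?_, ?_⟩
  · calc star W * W = z * (star W * W) + (1 - z) * (star W * W) := by
          rw [← add_mul, add_sub_cancel, one_mul]
      _ = 1 := by rw [g1, f2]; abel
  · calc W * star W = z * (W * star W) + (1 - z) * (W * star W) := by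
          rw [← add_mul, add_sub_cancel, one_mul]
      _ = 1 := by rw [f1, g2]; abel
  · have : star W * s * W = star x * x := by
      have e1 : s * W = x := by rw [hW, mul_add, hsx, hsu, add_zero]
      have h1' : star u * x = 0 := by simpa using congrArg star h1
      rw [mul_assoc, e1, hW, star_add, add_mul, h1', add_zero]
    rw [this]; exact hxA

end tr

end helpers

theorem stmt_16 (ℋ : Type*) [NormedAddCommGroup ℋ] [InnerProductSpace ℂ ℋ]
    [CompleteSpace ℋ] (R : Set (ℋ →L[ℂ] ℋ))
    (hvN : R = Set.centralizer (Set.centralizer R))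
    (hstar : ∀ x ∈ R, star x ∈ R)
    (hcd : ∀ P : Set (ℋ →L[ℂ] ℋ), P ⊆ R →
      (∀ p ∈ P, p ≠ 0 ∧ star p = p ∧ p * p = p) →
      (∀ p ∈ P, ∀ q ∈ P, p ≠ q → p * q = 0) → P.Countable)
    -- a system of 2×2 matrix units in R, implementing R ≅ (Z ⊗ R₀) ⊗ M₂(ℂ)
    (e : Fin 2 → Fin 2 → (ℋ →L[ℂ] ℋ)) (he : ∀ i j, e i j ∈ R)
    (hesum : ∑ i, e i i = 1) (hestar : ∀ i j, star (e i j) = e j i)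
    (hemul : ∀ i j k l, e i j * e k l = if j = k then e i l else 0)
    -- the faithful normal trace on R
    (τ : (ℋ →L[ℂ] ℋ) →ₗ[ℂ] ℂ) (hτ1 : τ 1 = 1)
    (hτtrace : ∀ x ∈ R, ∀ y ∈ R, τ (x * y) = τ (y * x))
    (hτpos : ∀ x ∈ R, 0 ≤ (τ (star x * x)).re ∧ (τ (star x * x)).im = 0)
    (hτfaithful : ∀ x ∈ R, τ (star x * x) = 0 → x = 0)
    -- A a maximal abelian von Neumann subalgebra of R
    (A : Set (ℋ →L[ℂ] ℋ)) (hAR : A ⊆ R) (hAstar : ∀ a ∈ A, star a ∈ A)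
    (hmasa : A = {x ∈ R | ∀ a ∈ A, a * x = x * a}) :
    ∃ w ∈ R, w ∈ unitary (ℋ →L[ℂ] ℋ) ∧ ∀ a ∈ A, τ (w * a) = 0 := by
  have hmem : ∀ x, x ∈ R ↔ ∀ t ∈ Set.centralizer R, t * x = x * t := by
    intro x
    constructor
    · intro hx; rw [hvN] at hx; exact fun t ht => hx t ht
    · intro hx; rw [hvN]; exact fun t ht => hx t ht
  let M : StarSubalgebra ℂ (ℋ →L[ℂ] ℋ) :=
    { carrier := R
      mul_mem' := by
        intro a b ha hb
        rw [hvN]; rw [hvN] at ha hb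
        exact Set.mul_mem_centralizer ha hb
      add_mem' := by
        intro a b ha hb
        rw [hvN]; rw [hvN] at ha hb
        exact Set.add_mem_centralizer ha hb
      algebraMap_mem' := by
        intro r
        rw [hmem]
        intro t _
        exact (Algebra.commutes r t).symm
      star_mem' := fun {a} ha => hstar a ha }
  have hMR : ∀ x, x ∈ M ↔ x ∈ R := fun x => Iff.rfl
  have hAm : ∀ x, x ∈ A ↔ x ∈ R ∧ ∀ a ∈ A, a * x = x * a := by
    intro x
    constructor
    · intro hx; rw [hmasa] at hx; exact hx
    · intro hx; rw [hmasa]; exact hx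
  have hmulA : ∀ a b, a ∈ A → b ∈ A → a * b ∈ A := by
    intro a b ha hb
    rw [hAm]
    refine ⟨M.mul_mem (hAR ha) (hAR hb), fun c hc => ?_⟩
    rw [← mul_assoc, ((hAm a).mp ha).2 c hc, mul_assoc, ((hAm b).mp hb).2 c hc, mul_assoc]
  have haddA : ∀ a b, a ∈ A → b ∈ A → a + b ∈ A := by
    intro a b ha hb
    rw [hAm]
    refine ⟨M.add_mem (hAR ha) (hAR hb), fun c hc => ?_⟩
    rw [mul_add, add_mul, ((hAm a).mp ha).2 c hc, ((hAm b).mp hb).2 c hc]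
  have halgA : ∀ r : ℂ, algebraMap ℂ (ℋ →L[ℂ] ℋ) r ∈ A := by
    intro r
    rw [hAm]
    exact ⟨M.algebraMap_mem r, fun c _ => (Algebra.commutes r c).symm⟩
  let A' : StarSubalgebra ℂ (ℋ →L[ℂ] ℋ) :=
    { carrier := A
      mul_mem' := fun {a b} ha hb => hmulA a b ha hb
      add_mem' := fun {a b} ha hb => haddA a b ha hb
      algebraMap_mem' := halgA
      star_mem' := fun {a} ha => hAstar a ha }
  have hM : IsDC M := by
    intro x hx
    rw [hMR, hmem]
    intro t ht
    exact hx t fun y hy => (ht y hy).symm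
  have hA : IsMasa M A' :=
    ⟨fun a ha => hAR ha, fun a ha b hb => ((hAm b).mp hb).2 a ha,
      fun x hx h => (hAm x).mpr ⟨hx, h⟩⟩
  have hτ : IsTr M τ := ⟨hτtrace, hτpos, hτfaithful⟩
  have hs : IsStarProjection (e 0 0) :=
    ⟨by rw [IsIdempotentElem, hemul]; simp, by rw [IsSelfAdjoint, hestar]⟩
  obtain ⟨W, hWM, hW1, hW2, hWA⟩ := conj_unitary hM hA hτ hs (he 0 0)
  have hE : e 0 0 + e 1 1 = 1 := by simpa [Fin.sum_univ_two] using hesum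
  have hwM : star W * (e 0 1 + e 1 0) * W ∈ M :=
    mul_mem (mul_mem (star_mem hWM) (add_mem (he 0 1) (he 1 0))) hWM
  have hws : star (star W * (e 0 1 + e 1 0) * W) = star W * (e 0 1 + e 1 0) * W := by
    simp only [star_mul, star_add, hestar, star_star, mul_assoc]
    rw [add_comm]
  have hsq : (e 0 1 + e 1 0) * (e 0 1 + e 1 0) = 1 := by
    rw [← hE]
    simp [mul_add, add_mul, hemul]
    abel
  have hww : (star W * (e 0 1 + e 1 0) * W) * (star W * (e 0 1 + e 1 0) * W) = 1 := by
    calc (star W * (e 0 1 + e 1 0) * W) * (star W * (e 0 1 + e 1 0) * W)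
        = star W * ((e 0 1 + e 1 0) * (W * star W) * (e 0 1 + e 1 0)) * W := by
          simp only [mul_assoc]
      _ = 1 := by rw [hW2, mul_one, hsq, mul_one, hW1]
  refine ⟨star W * (e 0 1 + e 1 0) * W, hwM, ?_, ?_⟩
  · rw [Unitary.mem_iff, hws]; exact ⟨hww, hww⟩
  intro a ha
  set p := star W * e 0 0 * W with hp
  set w := star W * (e 0 1 + e 1 0) * W with hw
  have hpw : p * w + w * p = w := by
    have : e 0 0 * (e 0 1 + e 1 0) + (e 0 1 + e 1 0) * e 0 0 = e 0 1 + e 1 0 := by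
      simp [mul_add, add_mul, hemul]
    calc p * w + w * p = star W * (e 0 0 * (W * star W) * (e 0 1 + e 1 0)
          + (e 0 1 + e 1 0) * (W * star W) * e 0 0) * W := by
          simp only [hp, hw, mul_assoc, mul_add, add_mul]
      _ = w := by rw [hW2, mul_one, mul_one, this]
  have hpwp : p * w * p = 0 := by
    have : e 0 0 * (e 0 1 + e 1 0) * e 0 0 = 0 := by
      simp [mul_add, add_mul, hemul]
    calc p * w * p = star W * (e 0 0 * (W * star W) * (e 0 1 + e 1 0) * (W * star W) * e 0 0)
          * W := by simp only [hp, hw, mul_assoc]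
      _ = 0 := by rw [hW2, mul_one, mul_one, this, mul_zero, zero_mul]
  have hpp : p * p = p := by
    calc p * p = star W * (e 0 0 * (W * star W) * e 0 0) * W := by simp only [hp, mul_assoc]
      _ = p := by rw [hW2, mul_one, hs.isIdempotentElem.eq]
  clear_value p w
  have hpM : p ∈ M := hA.le _ hWA
  have haM : a ∈ M := hAR ha
  have hpa : p * a = a * p := hA.comm p hWA a ha
  have t1 : τ (w * p * a) = τ (p * w * a) := by
    rw [mul_assoc, hpa, ← mul_assoc, hτ.tr _ (mul_mem hwM haM) _ hpM, mul_assoc]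
  have t2 : τ (p * w * a) = 0 := by
    have e1 : p * w * a = p * (p * w * a) := by
      rw [← mul_assoc, ← mul_assoc, hpp]
    rw [e1, hτ.tr _ hpM _ (mul_mem (mul_mem hpM hwM) haM), mul_assoc, ← hpa, ← mul_assoc,
      hpwp, zero_mul, map_zero]
  rw [← hpw, add_mul, map_add, t1, t2, add_zero]
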